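/- arXiv:math/0406570 — 3 statements merged into one kernel-verified Lean document; each statement's English description precedes it below -/
import Mathlib

section
/- Let g be an entire function on ℂ such that (i) |g(z)| ≤ C·e^{a(Re z)²}(1+|Im z|)^m for some constants C > 0, a > 0, m > 0, and (ii) ∫_ℝ |g(x)|^q/(1+|x|)^s dx < ∞ for some q ≥ 1 and s > 1. Then g is a polynomial with deg g ≤ min{m, (s−1)/q}; in particular, if s ≤ q + 1 then g is constant. -/
open Complex MeasureTheory Real Set
open scoped ComplexConjugate

/-- A function dominated by `M * exp (a * (re z) ^ 2)` in the closed first quadrant and by `M` on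
the positive real axis satisfies a bound with an error `exp (a * cot b * re z * im z)` in the
sector of opening `b < π / 2`. -/
lemma norm_le_mul_exp_of_sector {F : ℂ → ℂ} {M a b : ℝ} (ha : 0 ≤ a)
    (hb₀ : 0 < b) (hb : b < π / 2)
    (hd : ∀ z : ℂ, 0 ≤ z.re → 0 ≤ z.im → DifferentiableAt ℂ F z)
    (hF : ∀ z : ℂ, 0 ≤ z.re → 0 ≤ z.im → ‖F z‖ ≤ M * Real.exp (a * z.re ^ 2))
    (hre : ∀ x : ℝ, 0 ≤ x → ‖F x‖ ≤ M) {z : ℂ} (hz : z ≠ 0) (hz_im : 0 ≤ z.im)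
    (hz_arg : z.arg ≤ b) :
    ‖F z‖ ≤ M * Real.exp (a * Real.cos b / Real.sin b * (z.re * z.im)) := by
  set k : ℝ := a * Real.cos b / Real.sin b with hk
  have hcosb : 0 < Real.cos b := Real.cos_pos_of_mem_Ioo ⟨by linarith, hb⟩
  have hsinb : 0 < Real.sin b := Real.sin_pos_of_pos_of_lt_pi hb₀ (by linarith)
  have hk₀ : 0 ≤ k := by positivity
  have hM : 0 ≤ M := (norm_nonneg _).trans (hre 0 le_rfl)
  have hquad {ζ : ℂ} (h₀ : 0 ≤ ζ.im) (h₁ : ζ.im ≤ b) :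
      0 ≤ (Complex.exp ζ).re ∧ 0 ≤ (Complex.exp ζ).im := by
    rw [Complex.exp_re, Complex.exp_im]
    have := Real.cos_nonneg_of_mem_Icc (x := ζ.im) ⟨by linarith, by linarith⟩
    have := Real.sin_nonneg_of_nonneg_of_le_pi h₀ (by linarith)
    constructor <;> positivity
  let H : ℂ → ℂ := fun ζ =>
    F (Complex.exp ζ) * Complex.exp ((k / 2 : ℝ) * I * Complex.exp ζ ^ 2)
  have hH (ζ : ℂ) : ‖H ζ‖ =
      ‖F (Complex.exp ζ)‖ * Real.exp (-(k * ((Complex.exp ζ).re * (Complex.exp ζ).im))) := by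
    simp only [H, norm_mul, Complex.norm_exp]
    congr 2
    simp only [pow_two, Complex.mul_re, Complex.mul_im, ofReal_re, ofReal_im, I_re, I_im]
    ring
  have hHle {ζ : ℂ} (h₀ : 0 ≤ ζ.im) (h₁ : ζ.im ≤ b) :
      ‖H ζ‖ ≤ M * Real.exp (a * (Complex.exp ζ).re ^ 2
        - k * ((Complex.exp ζ).re * (Complex.exp ζ).im)) := by
    rw [hH, sub_eq_add_neg, Real.exp_add, ← mul_assoc M]
    exact mul_le_mul_of_nonneg_right (hF _ (hquad h₀ h₁).1 (hquad h₀ h₁).2) (Real.exp_pos _).le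
  have hstrip : ∀ ζ : ℂ, 0 ≤ ζ.im → ζ.im ≤ b → ‖H ζ‖ ≤ M := by
    intro ζ h₀ h₁
    refine PhragmenLindelof.horizontal_strip (a := 0) (b := b) ?_ ?_ ?_ ?_ h₀ h₁
    · apply DifferentiableOn.diffContOnCl
      intro w hw
      replace hw : w ∈ Complex.im ⁻¹' Icc 0 b :=
        closure_minimal (preimage_mono Ioo_subset_Icc_self)
          (isClosed_Icc.preimage Complex.continuous_im) hw
      apply DifferentiableAt.differentiableWithinAt
      exact ((hd _ (hquad hw.1 hw.2).1 (hquad hw.1 hw.2).2).comp w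
        Complex.differentiableAt_exp).mul (by fun_prop)
    · refine ⟨2, ?_, a, Asymptotics.IsBigO.of_bound M ?_⟩
      · rw [sub_zero, lt_div_iff₀ hb₀]; linarith
      · rw [Filter.eventually_inf_principal]
        refine Filter.Eventually.of_forall fun w hw => ?_
        refine (hHle hw.1.le hw.2.le).trans ?_
        rw [Real.norm_of_nonneg (Real.exp_pos _).le]
        gcongr
        obtain ⟨hx, hy⟩ := hquad hw.1.le hw.2.le
        have hxle : (Complex.exp w).re ^ 2 ≤ Real.exp (2 * |w.re|) := by
          calc (Complex.exp w).re ^ 2 ≤ Real.exp w.re ^ 2 := by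
                gcongr
                exact (Complex.re_le_norm _).trans (Complex.norm_exp w).le
            _ = Real.exp (2 * w.re) := by rw [← Real.exp_nat_mul]; norm_num
            _ ≤ _ := by gcongr; exact le_abs_self _
        have : 0 ≤ k * ((Complex.exp w).re * (Complex.exp w).im) := by positivity
        have := mul_le_mul_of_nonneg_left hxle ha
        linarith
    · intro w hw
      lift w to ℝ using hw
      rw [hH, ← Complex.ofReal_exp]
      simpa using hre _ (Real.exp_pos w).le
    · intro w hw
      refine (hHle (hw ▸ hb₀.le) hw.le).trans (le_of_eq ?_)
      rw [Complex.exp_re, Complex.exp_im, hw, hk]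
      have : a * (Real.exp w.re * Real.cos b) ^ 2 - a * Real.cos b / Real.sin b *
          (Real.exp w.re * Real.cos b * (Real.exp w.re * Real.sin b)) = 0 := by
        field_simp
        ring
      rw [this, Real.exp_zero, mul_one]
  have := hstrip (Complex.log z) (by rw [log_im]; exact arg_nonneg_iff.2 hz_im)
    (by rwa [log_im])
  rw [hH, Complex.exp_log hz, Real.exp_neg] at this
  rwa [← div_eq_mul_inv, div_le_iff₀ (Real.exp_pos _)] at this

/-- A Phragmén–Lindelöf principle at the critical order of the first quadrant: the growth
`exp (a * (re z) ^ 2)` degenerates on the imaginary axis, which replaces the usual assumption of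
order less than two. -/
lemma norm_le_of_quadrant {F : ℂ → ℂ} {M a : ℝ} (ha : 0 ≤ a)
    (hd : ∀ z : ℂ, 0 ≤ z.re → 0 ≤ z.im → DifferentiableAt ℂ F z)
    (hF : ∀ z : ℂ, 0 ≤ z.re → 0 ≤ z.im → ‖F z‖ ≤ M * Real.exp (a * z.re ^ 2))
    (hre : ∀ x : ℝ, 0 ≤ x → ‖F x‖ ≤ M) {z : ℂ} (hz_re : 0 ≤ z.re) (hz_im : 0 ≤ z.im) :
    ‖F z‖ ≤ M := by
  rcases hz_re.eq_or_lt with h | h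
  · simpa [← h] using hF z hz_re hz_im
  have hz : z ≠ 0 := by rintro rfl; simp at h
  have harg : z.arg < π / 2 :=
    (le_abs_self _).trans_lt (Complex.abs_arg_lt_pi_div_two_iff.2 (Or.inl h))
  have hlim : Filter.Tendsto
      (fun b : ℝ => M * Real.exp (a * Real.cos b / Real.sin b * (z.re * z.im)))
      (nhdsWithin (π / 2) (Iio (π / 2))) (nhds M) := by
    have hc : ContinuousAt
        (fun b : ℝ => M * Real.exp (a * Real.cos b / Real.sin b * (z.re * z.im))) (π / 2) := by
      have : Real.sin (π / 2) ≠ 0 := by simp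
      fun_prop (disch := assumption)
    simpa using hc.tendsto.mono_left nhdsWithin_le_nhds
  refine ge_of_tendsto hlim ?_
  filter_upwards [Ioo_mem_nhdsLT harg, Ioo_mem_nhdsLT (show (0 : ℝ) < π / 2 by positivity)]
    with b hb hb'
  exact norm_le_mul_exp_of_sector ha hb'.1 hb'.2 hd hF hre hz hz_im hb.1.le

lemma norm_le_pow_of_quadrant {f : ℂ → ℂ} {D a : ℝ} {N : ℕ} (ha : 0 ≤ a)
    (hd : Differentiable ℂ f)
    (hf : ∀ z : ℂ, ‖f z‖ ≤ D * Real.exp (a * z.re ^ 2) * (1 + ‖z‖) ^ N)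
    (hre : ∀ x : ℝ, ‖f x‖ ≤ D * (1 + |x|) ^ N) {z : ℂ} (hz_re : 0 ≤ z.re) (hz_im : 0 ≤ z.im) :
    ‖f z‖ ≤ D * 2 ^ N * (1 + ‖z‖) ^ N := by
  have hD : 0 ≤ D := by simpa using (norm_nonneg _).trans (hre 0)
  have hle {w : ℂ} (h : 0 ≤ w.re) : 1 + ‖w‖ ≤ 2 * ‖1 + w‖ := by
    have h₁ : 1 ≤ ‖1 + w‖ := by
      refine le_trans ?_ (Complex.re_le_norm _)
      simpa using h
    have h₂ : ‖w‖ ≤ ‖1 + w‖ := by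
      rw [← sq_le_sq₀ (norm_nonneg _) (norm_nonneg _), Complex.sq_norm, Complex.sq_norm,
        Complex.normSq_apply, Complex.normSq_apply]
      simp only [add_re, one_re, add_im, one_im, zero_add]
      nlinarith
    linarith
  have hpos {w : ℂ} (h : 0 ≤ w.re) : 0 < ‖1 + w‖ := by
    linarith [hle h, norm_nonneg w]
  have key : ‖f z / (1 + z) ^ N‖ ≤ D * 2 ^ N := by
    refine norm_le_of_quadrant (F := fun w => f w / (1 + w) ^ N) (a := a) ha ?_ ?_ ?_ hz_re hz_im
    · intro w hw _
      have : (1 + w) ^ N ≠ 0 := pow_ne_zero _ (norm_pos_iff.1 (hpos hw))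
      exact (hd w).div (by fun_prop) this
    · intro w hw _
      rw [norm_div, norm_pow, div_le_iff₀ (pow_pos (hpos hw) N)]
      refine (hf w).trans ?_
      calc _ ≤ D * Real.exp (a * w.re ^ 2) * (2 * ‖1 + w‖) ^ N := by gcongr; exact hle hw
        _ = _ := by rw [mul_pow]; ring
    · intro x hx
      have hx' : 0 ≤ (x : ℂ).re := by simpa
      rw [norm_div, norm_pow, div_le_iff₀ (pow_pos (hpos hx') N)]
      refine (hre x).trans ?_
      rw [mul_assoc, ← mul_pow]
      gcongr
      simpa using hle hx'
  rw [norm_div, norm_pow, div_le_iff₀ (pow_pos (hpos hz_re) N)] at key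
  refine key.trans ?_
  gcongr
  simpa using norm_add_le 1 z

/-- An entire function of growth `exp (a * (re z) ^ 2)` times a polynomial, which grows at most
polynomially on the real line, grows at most polynomially in the plane. -/
lemma norm_le_pow_of_norm_le_exp_re_sq {f : ℂ → ℂ} {D a : ℝ} {N : ℕ} (ha : 0 ≤ a)
    (hd : Differentiable ℂ f)
    (hf : ∀ z : ℂ, ‖f z‖ ≤ D * Real.exp (a * z.re ^ 2) * (1 + ‖z‖) ^ N)
    (hre : ∀ x : ℝ, ‖f x‖ ≤ D * (1 + |x|) ^ N) (z : ℂ) :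
    ‖f z‖ ≤ D * 2 ^ N * (1 + ‖z‖) ^ N := by
  wlog hz_re : 0 ≤ z.re generalizing f z
  · have := this (f := fun w => f (-w)) (by fun_prop) (fun w => by simpa using hf (-w))
      (fun x => by simpa using hre (-x)) (-z) (by simp only [neg_re]; linarith)
    simpa using this
  wlog hz_im : 0 ≤ z.im generalizing f z
  · have := this (f := conj ∘ f ∘ conj)
      (fun w => differentiableAt_conj_conj_iff.2 (hd _))
      (fun w => by simpa using hf (conj w))
      (fun x => by simpa using hre x) (conj z) (by simpa)
      (by simp only [conj_im]; linarith)
    simpa using this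
  exact norm_le_pow_of_quadrant ha hd hf hre hz_re hz_im

/-- Liouville's theorem for functions of polynomial growth. -/
lemma exists_polynomial_of_norm_le_pow {f : ℂ → ℂ} {D : ℝ} {N : ℕ} (hd : Differentiable ℂ f)
    (hf : ∀ z : ℂ, ‖f z‖ ≤ D * (1 + ‖z‖) ^ N) :
    ∃ P : Polynomial ℂ, ∀ z, f z = P.eval z := by
  have hD : 0 ≤ D := by simpa using (norm_nonneg _).trans (hf 0)
  have hzero : ∀ n, n ∉ Finset.range (N + 1) → iteratedDeriv n f 0 = 0 := by
    intro n hn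
    rw [Finset.mem_range, not_lt] at hn
    have hbd : ∀ R : ℝ, 1 ≤ R → ‖iteratedDeriv n f 0‖ ≤ n.factorial * (D * 2 ^ N) / R := by
      intro R hR
      have hR₀ : 0 < R := by linarith
      refine (norm_iteratedDeriv_le_of_forall_mem_sphere_norm_le (C := D * (2 * R) ^ N) n hR₀
        hd.diffContOnCl fun z hz => ?_).trans ?_
      · refine (hf z).trans ?_
        rw [mem_sphere_zero_iff_norm] at hz
        rw [hz]
        gcongr
        linarith
      · rw [div_le_div_iff₀ (by positivity) hR₀]
        calc n.factorial * (D * (2 * R) ^ N) * R = n.factorial * (D * 2 ^ N) * R ^ (N + 1) := by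
              rw [mul_pow]; ring
          _ ≤ _ := by gcongr
    rw [← norm_le_zero_iff]
    exact ge_of_tendsto (Filter.Tendsto.const_div_atTop Filter.tendsto_id _)
      (Filter.eventually_atTop.2 ⟨1, hbd⟩)
  refine ⟨∑ n ∈ Finset.range (N + 1),
    Polynomial.C ((n.factorial : ℂ)⁻¹ * iteratedDeriv n f 0) * Polynomial.X ^ n, fun z => ?_⟩
  rw [← taylorSeries_eq_of_entire' 0 z hd, tsum_eq_sum (s := Finset.range (N + 1))]
  · simp [Polynomial.eval_finsetSum]
  · intro n hn
    simp [hzero n hn]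

lemma exists_mul_norm_pow_le_norm_eval {P : Polynomial ℂ} (hP : P ≠ 0) :
    ∃ c > 0, ∃ R : ℝ, 1 ≤ R ∧ ∀ z : ℂ, R ≤ ‖z‖ → c * ‖z‖ ^ P.natDegree ≤ ‖P.eval z‖ := by
  obtain ⟨K, hK, h⟩ := (Polynomial.isEquivalent_cobounded_leading_monomial
    (P := P)).isBigO_symm.exists_pos
  obtain ⟨R, -, hR⟩ := Filter.hasBasis_cobounded_norm.eventually_iff.1 h.bound
  have hl : 0 < ‖P.leadingCoeff‖ := by simpa
  refine ⟨‖P.leadingCoeff‖ / K, by positivity, max 1 R, le_max_left _ _, fun z hz => ?_⟩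
  have := hR (x := z) ((le_max_right _ _).trans hz)
  rw [norm_mul, norm_pow] at this
  rw [div_mul_eq_mul_div, div_le_iff₀ hK]
  linarith

/-- The bound on a primitive of `g` vanishing at zero given by a bound on `g` that is monotone in
`|re z|` and `|im z|`. -/
lemma norm_primitive_le {g G : ℂ → ℂ} {C a m : ℝ} (hC : 0 ≤ C) (ha : 0 ≤ a) (hm : 0 ≤ m)
    (hbound : ∀ z : ℂ, ‖g z‖ ≤ C * Real.exp (a * z.re ^ 2) * (1 + |z.im|) ^ m)
    (hG₀ : G 0 = 0) (hG : ∀ z, HasDerivAt G (g z) z) (z : ℂ) :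
    ‖G z‖ ≤ C * Real.exp (a * z.re ^ 2) * (1 + |z.im|) ^ m * ‖z‖ := by
  have := Convex.norm_image_sub_le_of_norm_hasDerivWithin_le (f := G) (f' := g)
    (s := Icc (-|z.re|) |z.re| ×ℂ Icc (-|z.im|) |z.im|) (x := 0) (y := z)
    (C := C * Real.exp (a * z.re ^ 2) * (1 + |z.im|) ^ m)
    (fun w _ => (hG w).hasDerivWithinAt) (fun w hw => ?_)
    (((convex_Icc _ _).linear_preimage reLm).inter ((convex_Icc _ _).linear_preimage imLm))
    (by simp [mem_reProdIm])
    (by simp [mem_reProdIm, neg_abs_le, le_abs_self])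
  · simpa [hG₀] using this
  · refine (hbound w).trans ?_
    have h₁ : w.re ^ 2 ≤ z.re ^ 2 := sq_le_sq.2 (abs_le.2 hw.1)
    have h₂ : |w.im| ≤ |z.im| := abs_le.2 hw.2
    gcongr

lemma norm_integral_le_of_weighted_integrable {g : ℝ → ℂ} {q s : ℝ} (hq : 1 ≤ q) (hs : 0 ≤ s)
    (hg : Continuous g)
    (hint : Integrable (fun x : ℝ => ‖g x‖ ^ q / (1 + |x|) ^ s)) (x : ℝ) :
    ‖∫ t in (0 : ℝ)..x, g t‖ ≤
      |x| + (1 + |x|) ^ s * ∫ t : ℝ, ‖g t‖ ^ q / (1 + |t|) ^ s := by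
  have hfin : volume (uIoc 0 x) ≠ ⊤ := by simp [uIoc]
  calc ‖∫ t in (0 : ℝ)..x, g t‖ ≤ ∫ t in uIoc 0 x, ‖g t‖ :=
        intervalIntegral.norm_integral_le_integral_norm_uIoc
    _ ≤ ∫ t in uIoc 0 x, (1 + (1 + |x|) ^ s * (‖g t‖ ^ q / (1 + |t|) ^ s)) := by
        refine setIntegral_mono_on
          (intervalIntegrable_iff.1 (hg.norm.intervalIntegrable 0 x))
          ((integrableOn_const hfin).add (hint.integrableOn.const_mul _))
          measurableSet_uIoc fun t ht => ?_
        have htx : |t| ≤ |x| := by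
          simpa using abs_sub_left_of_mem_uIcc (uIoc_subset_uIcc ht)
        have h₁ : ‖g t‖ ≤ 1 + ‖g t‖ ^ q := by
          rcases le_total ‖g t‖ 1 with h | h
          · have : 0 ≤ ‖g t‖ ^ q := by positivity
            linarith
          · have := Real.rpow_le_rpow_of_exponent_le h hq
            rw [Real.rpow_one] at this
            linarith
        have h₂ : ‖g t‖ ^ q ≤ (1 + |x|) ^ s * (‖g t‖ ^ q / (1 + |t|) ^ s) := by
          rw [mul_div_assoc', le_div_iff₀ (by positivity), mul_comm]
          gcongr
        linarith
    _ = |x| + (1 + |x|) ^ s * ∫ t in uIoc 0 x, ‖g t‖ ^ q / (1 + |t|) ^ s := by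
        have hone : IntegrableOn (fun _ : ℝ => (1 : ℝ)) (uIoc 0 x) := integrableOn_const hfin
        rw [integral_add hone (hint.integrableOn.const_mul _),
          integral_const_mul]
        simp [Measure.real, uIoc, max_sub_min_eq_abs]
    _ ≤ _ := by
        gcongr
        · exact Filter.Eventually.of_forall fun t => by positivity
        · exact Measure.restrict_le_self

lemma natDegree_le_of_norm_eval_le {P : Polynomial ℂ} {C m : ℝ} (hm : 0 ≤ m)
    (hP : ∀ y : ℝ, ‖P.eval (y * I)‖ ≤ C * (1 + |y|) ^ m) : (P.natDegree : ℝ) ≤ m := by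
  rcases eq_or_ne P 0 with rfl | hP₀
  · simpa
  have hC : 0 ≤ C := by simpa using (norm_nonneg _).trans (hP 0)
  obtain ⟨c, hc, R, hR, h⟩ := exists_mul_norm_pow_le_norm_eval hP₀
  by_contra! hlt
  obtain ⟨y, hy, hy'⟩ := (((tendsto_rpow_atTop (sub_pos.2 hlt)).eventually_gt_atTop
    (C * 2 ^ m / c)).and (Filter.eventually_ge_atTop R)).exists
  have hy₀ : 0 < y := by linarith
  have h₁ := (h (y * I) (by simpa [abs_of_pos hy₀])).trans (hP y)
  rw [Real.rpow_sub hy₀, Real.rpow_natCast, div_lt_div_iff₀ hc (by positivity)] at hy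
  have h₂ : C * (1 + y) ^ m ≤ C * (2 ^ m * y ^ m) := by
    rw [← Real.mul_rpow (by norm_num) hy₀.le]
    gcongr
    linarith
  simp only [norm_mul, norm_real, norm_I, mul_one, Real.norm_eq_abs, abs_of_pos hy₀] at h₁
  linarith

lemma natDegree_lt_of_weighted_integrable {P : Polynomial ℂ} {q s : ℝ} (hq : 0 < q) (hs : 1 < s)
    (hint : Integrable (fun x : ℝ => ‖P.eval (x : ℂ)‖ ^ q / (1 + |x|) ^ s)) :
    (P.natDegree : ℝ) < (s - 1) / q := by
  rcases eq_or_ne P 0 with rfl | hP₀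
  · simpa using div_pos (sub_pos.2 hs) hq
  obtain ⟨c, hc, R, hR, h⟩ := exists_mul_norm_pow_le_norm_eval hP₀
  have hR₀ : 0 < R := by linarith
  have hpow : IntegrableOn (fun x : ℝ => x ^ (P.natDegree * q - s)) (Ioi R) := by
    refine Integrable.mono' (hint.integrableOn.const_mul (2 ^ s / c ^ q)) (by fun_prop) ?_
    filter_upwards [ae_restrict_mem measurableSet_Ioi] with x hx
    have hxR : R < x := hx
    have hx₀ : 0 < x := hR₀.trans hxR
    have h₁ : c * x ^ P.natDegree ≤ ‖P.eval (x : ℂ)‖ := by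
      simpa [abs_of_pos hx₀] using h x (by simpa [abs_of_pos hx₀] using hxR.le)
    have h₂ : c ^ q * x ^ (P.natDegree * q) ≤ ‖P.eval (x : ℂ)‖ ^ q := by
      rw [Real.rpow_mul hx₀.le, Real.rpow_natCast, ← Real.mul_rpow hc.le (by positivity)]
      gcongr
    have h₃ : (1 + |x|) ^ s ≤ 2 ^ s * x ^ s := by
      rw [← Real.mul_rpow (by norm_num) hx₀.le, abs_of_pos hx₀]
      gcongr
      linarith
    rw [Real.norm_of_nonneg (by positivity), Real.rpow_sub hx₀]
    calc x ^ (P.natDegree * q) / x ^ s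
        = 2 ^ s / c ^ q * (c ^ q * x ^ (P.natDegree * q) / (2 ^ s * x ^ s)) := by
          field_simp
      _ ≤ _ := by gcongr
  rw [integrableOn_Ioi_rpow_iff hR₀] at hpow
  rw [lt_div_iff₀ hq]
  linarith

lemma exists_polynomial_of_weighted_integrable {g : ℂ → ℂ} {C a m q s : ℝ}
    (hC : 0 ≤ C) (ha : 0 ≤ a) (hm : 0 ≤ m) (hq : 1 ≤ q) (hs : 0 ≤ s)
    (hentire : Differentiable ℂ g)
    (hbound : ∀ z : ℂ, ‖g z‖ ≤ C * Real.exp (a * z.re ^ 2) * (1 + |z.im|) ^ m)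
    (hint : Integrable (fun x : ℝ => ‖g x‖ ^ q / (1 + |x|) ^ s)) :
    ∃ P : Polynomial ℂ, ∀ z, g z = P.eval z := by
  obtain ⟨G, hG₀, hG⟩ := hentire.isExactOn_univ.with_val_at 0 0
  replace hG : ∀ z, HasDerivAt G (g z) z := fun z => hG z (mem_univ z)
  obtain ⟨N, hN⟩ := exists_nat_ge (max (m + 1) s)
  have hmN : m + 1 ≤ N := (le_max_left _ _).trans hN
  have hsN : s ≤ N := (le_max_right _ _).trans hN
  have hN₁ : 1 ≤ N := by exact_mod_cast (by linarith : (1 : ℝ) ≤ N)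
  set J := ∫ t : ℝ, ‖g t‖ ^ q / (1 + |t|) ^ s
  have hJ : 0 ≤ J := integral_nonneg fun t => by positivity
  have hreal (x : ℝ) : ‖G x‖ ≤ (C + (1 + J)) * (1 + |x|) ^ N := by
    have hcont : Continuous fun t : ℝ => g t := hentire.continuous.comp continuous_ofReal
    have hFTC : ∫ t in (0 : ℝ)..x, g t = G x := by
      rw [intervalIntegral.integral_eq_sub_of_hasDerivAt (f := fun t : ℝ => G t)
        (fun t _ => (hG t).comp_ofReal) (hcont.intervalIntegrable _ _)]
      simp [hG₀]
    have h₁ := norm_integral_le_of_weighted_integrable hq hs hcont hint x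
    rw [hFTC] at h₁
    have hx : 1 ≤ 1 + |x| := by simp
    have h₂ : |x| ≤ (1 + |x|) ^ N := by
      have := le_self_pow₀ hx (by omega : N ≠ 0)
      linarith
    have h₃ : (1 + |x|) ^ s ≤ (1 + |x|) ^ N := by
      rw [← Real.rpow_natCast]
      exact Real.rpow_le_rpow_of_exponent_le hx hsN
    have h₄ := mul_le_mul_of_nonneg_right h₃ hJ
    have : 0 ≤ C * (1 + |x|) ^ N := by positivity
    linarith
  have hplane (z : ℂ) :
      ‖G z‖ ≤ (C + (1 + J)) * Real.exp (a * z.re ^ 2) * (1 + ‖z‖) ^ N := by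
    refine (norm_primitive_le hC ha hm hbound hG₀ hG z).trans ?_
    rw [mul_assoc]
    gcongr
    · linarith
    · calc (1 + |z.im|) ^ m * ‖z‖ ≤ (1 + ‖z‖) ^ m * (1 + ‖z‖) := by
            gcongr
            · exact Complex.abs_im_le_norm z
            · linarith
        _ = (1 + ‖z‖) ^ (m + 1) := by
            rw [Real.rpow_add (by positivity), Real.rpow_one]
        _ ≤ (1 + ‖z‖) ^ N := by
            rw [← Real.rpow_natCast]
            exact Real.rpow_le_rpow_of_exponent_le (by simp) hmN
  have hGd : Differentiable ℂ G := fun z => (hG z).differentiableAt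
  obtain ⟨P, hP⟩ := exists_polynomial_of_norm_le_pow hGd
    (norm_le_pow_of_norm_le_exp_re_sq ha hGd hplane hreal)
  refine ⟨P.derivative, fun z => (hG z).unique ?_⟩
  rw [funext hP]
  exact P.hasDerivAt z

/-- **One-variable entire-function polynomial lemma** (Lemma 2.2, `d = 1`, `Q ≡ 1`).
An entire function `g` with `|g(z)| ≤ C e^{a (Re z)²} (1+|Im z|)^m` and
`∫_ℝ |g(x)|^q / (1+|x|)^s dx < ∞` (for `q ≥ 1`, `s > 1`) is a polynomial of degree
at most `min{m, (s-1)/q}`; in particular, it is constant if `s ≤ q + 1`. -/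
theorem stmt_1 (g : ℂ → ℂ) (C a m q s : ℝ)
    (hC : 0 < C) (ha : 0 < a) (hm : 0 < m) (hq : 1 ≤ q) (hs : 1 < s)
    (hentire : Differentiable ℂ g)
    (hbound : ∀ z : ℂ, ‖g z‖ ≤ C * Real.exp (a * z.re ^ 2) * (1 + |z.im|) ^ m)
    (hint : Integrable (fun x : ℝ => ‖g x‖ ^ q / (1 + |x|) ^ s)) :
    ∃ P : Polynomial ℂ, (∀ z : ℂ, g z = P.eval z) ∧
      (P.natDegree : ℝ) ≤ min m ((s - 1) / q) ∧
      (s ≤ q + 1 → ∃ c : ℂ, ∀ z : ℂ, g z = c) := by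
  obtain ⟨P, hP⟩ := exists_polynomial_of_weighted_integrable hC.le ha.le hm.le hq (by linarith)
    hentire hbound hint
  have hdeg_lt : (P.natDegree : ℝ) < (s - 1) / q :=
    natDegree_lt_of_weighted_integrable (by linarith) hs (by simpa only [hP] using hint)
  have hdeg_le : (P.natDegree : ℝ) ≤ m :=
    natDegree_le_of_norm_eval_le (C := C) hm.le fun y => by
      simpa [← hP] using hbound (y * I)
  refine ⟨P, hP, le_min hdeg_le hdeg_lt.le, fun hsq => ⟨P.coeff 0, fun z => ?_⟩⟩
  have hdeg : P.natDegree = 0 := by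
    have : (P.natDegree : ℝ) < 1 :=
      hdeg_lt.trans_le ((div_le_one (by linarith)).2 (by linarith))
    exact Nat.lt_one_iff.1 (by exact_mod_cast this)
  rw [hP, Polynomial.eq_C_of_natDegree_eq_zero hdeg]
  simp
end

section
/- (Hardy's theorem, sharp case on ℝ.) Let f be a measurable function on ℝ with |f(x)| ≤ C e^{-ax²} and |f̂(ξ)| ≤ C e^{-bξ²} for all x, ξ ∈ ℝ, where a, b > 0. If ab > 1/4 then f = 0 a.e.; if ab = 1/4 then f is a constant multiple of e^{-ax²}. -/
open Complex MeasureTheory Real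
open scoped FourierTransform

/-- An integrable function on `ℝ` with vanishing Fourier transform is zero almost everywhere. -/
theorem ae_eq_zero_of_integral_mul_cexp_eq_zero {h : ℝ → ℂ} (hh : Integrable h)
    (h0 : ∀ ξ : ℝ, ∫ x : ℝ, h x * cexp (-I * x * ξ) = 0) : h =ᵐ[volume] 0 := by
  have hF : 𝓕 h = 0 := by
    ext ξ
    rw [Real.fourier_real_eq_integral_exp_smul, Pi.zero_apply, ← h0 (2 * π * ξ)]
    congr 1 with x
    rw [smul_eq_mul, mul_comm]
    congr 2
    push_cast
    ring
  refine ae_eq_zero_of_integral_contDiff_smul_eq_zero hh.locallyIntegrable fun g hg hgs => ?_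
  let G : SchwartzMap ℝ ℂ := HasCompactSupport.toSchwartzMap (f := fun x => (g x : ℂ))
    (hgs.comp_left (g := ofReal) ofReal_zero) (ofRealCLM.contDiff.comp hg)
  have key := VectorFourier.integral_fourierIntegral_smul_eq_flip (L := innerₗ ℝ)
    Real.continuous_fourierChar continuous_inner hh (𝓕⁻ G).integrable (μ := volume) (ν := volume)
  rw [flip_innerₗ] at key
  change ∫ ξ, (𝓕 h) ξ • (𝓕⁻ G) ξ = ∫ x, h x • (𝓕 ((𝓕⁻ G : SchwartzMap ℝ ℂ) : ℝ → ℂ)) x at key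
  rw [← SchwartzMap.fourier_coe, FourierTransform.fourier_fourierInv_eq, hF] at key
  simp only [Pi.zero_apply, zero_smul, integral_zero] at key
  rw [key]
  congr 1 with x
  change (g x) • h x = h x • (g x : ℂ)
  simp [mul_comm]

/-- A Phragmén–Lindelöf principle at the critical order: an entire function bounded by
`K * exp (b * z.re ^ 2)` everywhere and by `K` on the real axis is bounded by `K` on the closed first
quadrant. -/
theorem norm_le_of_norm_le_exp_re_sq_of_quadrant {G : ℂ → ℂ} (hG : Differentiable ℂ G) {K b : ℝ}
    (hb : 0 < b) (hexp : ∀ z : ℂ, ‖G z‖ ≤ K * Real.exp (b * z.re ^ 2))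
    (hreal : ∀ x : ℝ, ‖G x‖ ≤ K) {z : ℂ} (hre : 0 ≤ z.re) (him : 0 ≤ z.im) : ‖G z‖ ≤ K := by
  have hK : 0 ≤ K := (norm_nonneg _).trans (hreal 0)
  rcases hre.eq_or_lt with hre | hre
  · simpa [← hre] using hexp z
  have hz0 : z ≠ 0 := by rintro rfl; simp at hre
  have harg : z.arg < π / 2 := (Complex.abs_arg_lt_pi_div_two_iff.2 (.inl hre)) |> abs_lt.1 |>.2
  have harg0 : 0 ≤ z.arg := Complex.arg_nonneg_iff.2 him
  set ε : ℝ → ℝ := fun φ => b * Real.cos φ / (2 * Real.sin φ) with hε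
  have hnorm (δ : ℝ) (w : ℂ) :
      ‖G w * cexp (I * δ * w ^ 2)‖ = ‖G w‖ * Real.exp (-(2 * δ * (w.re * w.im))) := by
    rw [norm_mul, Complex.norm_exp]
    congr 2
    simp [pow_two]
    ring
  have key : ∀ φ ∈ Set.Ioo z.arg (π / 2),
      ‖G z‖ * Real.exp (-(2 * ε φ * (z.re * z.im))) ≤ K := by
    rintro φ ⟨hφ1, hφ2⟩
    have hφ0 : 0 < φ := harg0.trans_lt hφ1
    have hs : 0 < Real.sin φ := Real.sin_pos_of_pos_of_lt_pi hφ0 (by linarith [Real.pi_pos])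
    have hc : 0 < Real.cos φ := Real.cos_pos_of_mem_Ioo ⟨by linarith, hφ2⟩
    have hε0 : 0 ≤ ε φ := by positivity
    have hd : Differentiable ℂ fun u : ℂ => G (cexp u) * cexp (I * ε φ * cexp u ^ 2) := by
      fun_prop
    have := PhragmenLindelof.horizontal_strip (a := 0) (b := φ) (C := K) (z := Complex.log z)
      hd.diffContOnCl ?_ ?_ ?_ (by simpa [Complex.log_im] using harg0)
      (by simpa [Complex.log_im] using hφ1.le)
    · simpa only [Complex.exp_log hz0, hnorm] using this
    · refine ⟨2, ?_, b, ?_⟩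
      · rw [sub_zero, lt_div_iff₀ hφ0]; linarith
      · refine .of_bound K ?_
        refine Filter.mem_inf_of_right fun u hu => ?_
        have hu1 : 0 < u.im := hu.1
        have hu2 : u.im < φ := hu.2
        have h1 : 0 ≤ Real.sin u.im := Real.sin_nonneg_of_nonneg_of_le_pi hu1.le (by linarith)
        have h2 : 0 ≤ Real.cos u.im := Real.cos_nonneg_of_mem_Icc ⟨by linarith, by linarith⟩
        show ‖G (cexp u) * cexp (I * ε φ * cexp u ^ 2)‖ ≤ _
        rw [hnorm, Complex.exp_re, Complex.exp_im, Real.norm_eq_abs, Real.abs_exp]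
        calc _ ≤ ‖G (cexp u)‖ * 1 := by
              gcongr
              rw [Real.exp_le_one_iff, neg_nonpos]
              positivity
          _ ≤ K * Real.exp (b * (cexp u).re ^ 2) := by simpa using hexp _
          _ ≤ _ := by
              gcongr
              rw [Complex.exp_re, mul_pow, ← Real.exp_nat_mul]
              calc _ ≤ Real.exp (2 * u.re) * 1 := by
                    push_cast
                    gcongr
                    exact Real.cos_sq_le_one _
                _ ≤ _ := by
                    rw [mul_one]
                    gcongr
                    exact le_abs_self _
    · intro u hu
      rw [hnorm, Complex.exp_im, hu]
      have : cexp u = (Real.exp u.re : ℝ) := by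
        apply Complex.ext <;> simp [Complex.exp_re, Complex.exp_im, hu]
      rw [this]
      simpa using hreal (Real.exp u.re)
    · intro u hu
      rw [hnorm]
      calc _ ≤ K * Real.exp (b * (cexp u).re ^ 2) *
            Real.exp (-(2 * ε φ * ((cexp u).re * (cexp u).im))) := by
            gcongr
            exact hexp _
        _ = K := by
            rw [mul_assoc, ← Real.exp_add, Complex.exp_re, Complex.exp_im, hu, hε]
            convert mul_one K
            rw [Real.exp_eq_one_iff]
            field_simp
            ring
  have hlim : Filter.Tendsto (fun φ => ‖G z‖ * Real.exp (-(2 * ε φ * (z.re * z.im))))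
      (nhdsWithin (π / 2) (Set.Iio (π / 2))) (nhds ‖G z‖) := by
    have hcont : ContinuousAt (fun φ => ‖G z‖ * Real.exp (-(2 * ε φ * (z.re * z.im)))) (π / 2) := by
      have : ContinuousAt ε (π / 2) := by
        refine ContinuousAt.div (by fun_prop) (by fun_prop) (by simp)
      fun_prop
    have h := hcont.tendsto
    simp only [hε, Real.cos_pi_div_two, mul_zero, zero_div, zero_mul, neg_zero, Real.exp_zero,
      mul_one] at h
    exact h.mono_left nhdsWithin_le_nhds
  exact le_of_tendsto hlim (Filter.mem_of_superset (Ioo_mem_nhdsLT harg) key)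

/-- An entire function bounded on the real axis and dominated by `K * exp (b * z.re ^ 2)` is constant. -/
theorem exists_const_of_norm_le_exp_re_sq {G : ℂ → ℂ} (hG : Differentiable ℂ G) {K b : ℝ}
    (hb : 0 < b) (hexp : ∀ z : ℂ, ‖G z‖ ≤ K * Real.exp (b * z.re ^ 2))
    (hreal : ∀ x : ℝ, ‖G x‖ ≤ K) : ∃ c : ℂ, ∀ z, G z = c := by
  have right_half {G : ℂ → ℂ} (hG : Differentiable ℂ G)
      (hexp : ∀ z : ℂ, ‖G z‖ ≤ K * Real.exp (b * z.re ^ 2))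
      (hreal : ∀ x : ℝ, ‖G x‖ ≤ K) (z : ℂ) (hre : 0 ≤ z.re) : ‖G z‖ ≤ K := by
    rcases le_total 0 z.im with him | him
    · exact norm_le_of_norm_le_exp_re_sq_of_quadrant hG hb hexp hreal hre him
    · have := norm_le_of_norm_le_exp_re_sq_of_quadrant
        (G := star ∘ G ∘ star) (z := star z)
        (fun w => differentiableAt_conj_conj_iff.2 (hG _)) hb (fun w => by simpa using hexp (star w))
        (fun x => by simpa using hreal x) (by simpa using hre) (by simpa using him)
      simpa using this
  have bdd (z : ℂ) : ‖G z‖ ≤ K := by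
    rcases le_total 0 z.re with hre | hre
    · exact right_half hG hexp hreal z hre
    · have := right_half (G := fun w => G (-w)) (by fun_prop) (fun w => by simpa using hexp (-w))
        (fun x => by simpa using hreal (-x)) (-z) (by simpa using hre)
      simpa using this
  refine hG.exists_const_forall_eq_of_bounded ?_
  exact (Metric.isBounded_closedBall (x := (0 : ℂ)) (r := K)).subset
    (Set.range_subset_iff.2 fun z => by simpa using bdd z)

/-- A Gaussian with a real exponential weight is integrable. -/
theorem integrable_exp_neg_mul_sq_add_mul {a : ℝ} (ha : 0 < a) (r : ℝ) :
    Integrable fun x : ℝ => Real.exp (-a * x ^ 2 + r * x) := by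
  refine (integrable_cexp_quadratic (b := a) (by simpa using ha) r 0).norm.congr (.of_forall ?_)
  intro x
  simp [Complex.norm_exp, pow_two]

theorem norm_mul_cexp_le {w : ℂ} {C a x : ℝ} (hw : ‖w‖ ≤ C * Real.exp (-a * x ^ 2)) (z : ℂ) :
    ‖w * cexp (-I * x * z)‖ ≤ C * Real.exp (-a * x ^ 2 + z.im * x) := by
  have hre : (-I * x * z).re = z.im * x := by simp [mul_comm]
  rw [norm_mul, Complex.norm_exp, hre, Real.exp_add, ← mul_assoc]
  exact mul_le_mul_of_nonneg_right hw (Real.exp_pos _).le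

theorem integrable_mul_cexp {f : ℝ → ℂ} {C a : ℝ} (ha : 0 < a)
    (hmeas : AEStronglyMeasurable f volume) (hf : ∀ x, ‖f x‖ ≤ C * Real.exp (-a * x ^ 2)) (z : ℂ) :
    Integrable fun x : ℝ => f x * cexp (-I * x * z) := by
  refine ((integrable_exp_neg_mul_sq_add_mul ha z.im).const_mul C).mono'
    (hmeas.mul (by fun_prop)) (.of_forall fun x => norm_mul_cexp_le (hf x) z)

theorem norm_integral_mul_cexp_le {f : ℝ → ℂ} {C a : ℝ} (ha : 0 < a)
    (hf : ∀ x, ‖f x‖ ≤ C * Real.exp (-a * x ^ 2)) (z : ℂ) :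
    ‖∫ x : ℝ, f x * cexp (-I * x * z)‖ ≤
      C * (∫ x : ℝ, Real.exp (-a * x ^ 2)) * Real.exp (z.im ^ 2 / (4 * a)) := by
  have hsq (x : ℝ) : Real.exp (-a * x ^ 2 + z.im * x) =
      Real.exp (-a * (x - z.im / (2 * a)) ^ 2) * Real.exp (z.im ^ 2 / (4 * a)) := by
    rw [← Real.exp_add]
    congr 1
    field_simp
    ring
  calc _ ≤ ∫ x : ℝ, C * Real.exp (-a * x ^ 2 + z.im * x) := by
        refine norm_integral_le_of_norm_le ((integrable_exp_neg_mul_sq_add_mul ha z.im).const_mul C)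
          (.of_forall fun x => norm_mul_cexp_le (hf x) z)
    _ = _ := by
        simp_rw [hsq]
        rw [integral_const_mul, integral_mul_const,
          integral_sub_right_eq_self (fun x => Real.exp (-a * x ^ 2)), mul_assoc]

/-- The Fourier transform of a function with Gaussian decay extends to an entire function. -/
theorem differentiable_integral_mul_cexp {f : ℝ → ℂ} {C a : ℝ} (ha : 0 < a)
    (hmeas : AEStronglyMeasurable f volume) (hf : ∀ x, ‖f x‖ ≤ C * Real.exp (-a * x ^ 2)) :
    Differentiable ℂ fun z : ℂ => ∫ x : ℝ, f x * cexp (-I * x * z) := by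
  intro z₀
  set R : ℝ := |z₀.im| + 2
  have hbound := ((integrable_exp_neg_mul_sq_add_mul ha R).add
    (integrable_exp_neg_mul_sq_add_mul ha (-R))).const_mul C
  refine (hasDerivAt_integral_of_dominated_loc_of_deriv_le (Metric.ball_mem_nhds z₀ one_pos)
    (F' := fun z x => f x * (cexp (-I * x * z) * (-I * x)))
    (.of_forall fun z => (integrable_mul_cexp ha hmeas hf z).aestronglyMeasurable)
    (integrable_mul_cexp ha hmeas hf z₀) (hmeas.mul (by fun_prop))
    (.of_forall fun x z hz => ?_) hbound (.of_forall fun x z _ => ?_)).2.differentiableAt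
  · have him : |z.im| ≤ |z₀.im| + 1 := by
      have h1 : |(z - z₀).im| ≤ ‖z - z₀‖ := Complex.abs_im_le_norm _
      have h2 : ‖z - z₀‖ < 1 := by simpa [dist_eq_norm] using hz
      rw [Complex.sub_im] at h1
      have := abs_sub_abs_le_abs_sub z.im z₀.im
      linarith
    have hC : 0 ≤ C * Real.exp (-a * x ^ 2) := (norm_nonneg _).trans (hf x)
    have h1 : ‖cexp (-I * x * z) * (-I * x)‖ ≤ Real.exp (R * |x|) := by
      have hre : (-I * x * z).re = x * z.im := by simp
      have hx : ‖-I * (x : ℂ)‖ = |x| := by simp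
      rw [norm_mul, Complex.norm_exp, hre, hx]
      calc _ ≤ Real.exp ((|z₀.im| + 1) * |x|) * Real.exp |x| := by
            refine mul_le_mul (Real.exp_le_exp.2 ?_) (by linarith [Real.add_one_le_exp |x|])
              (abs_nonneg x) (Real.exp_pos _).le
            calc _ ≤ |x * z.im| := le_abs_self _
              _ = |z.im| * |x| := by rw [abs_mul, mul_comm]
              _ ≤ _ := by gcongr
        _ = _ := by rw [← Real.exp_add]; congr 1; simp only [R]; ring
    have h2 : Real.exp (R * |x|) ≤ Real.exp (R * x) + Real.exp (-R * x) := by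
      rcases abs_cases x with ⟨h, _⟩ | ⟨h, _⟩ <;> rw [h]
      · linarith [Real.exp_pos (-R * x)]
      · rw [mul_neg, ← neg_mul]
        linarith [Real.exp_pos (R * x)]
    rw [norm_mul]
    calc _ ≤ C * Real.exp (-a * x ^ 2) * (Real.exp (R * x) + Real.exp (-R * x)) :=
          mul_le_mul (hf x) (h1.trans h2) (norm_nonneg _) hC
      _ = _ := by
          simp only [Pi.add_apply, Real.exp_add]
          ring
  · have : HasDerivAt (fun w : ℂ => -I * x * w) (-I * x) z := by
      simpa using (hasDerivAt_id z).const_mul (-I * (x : ℂ))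
    exact this.cexp.const_mul _

/-- The equality case of Hardy's theorem on the Fourier side. -/
theorem exists_integral_mul_cexp_eq_gaussian {f : ℝ → ℂ} {C D a : ℝ} (ha : 0 < a)
    (hmeas : AEStronglyMeasurable f volume) (hf : ∀ x, ‖f x‖ ≤ C * Real.exp (-a * x ^ 2))
    (hfh : ∀ ξ : ℝ, ‖∫ x : ℝ, f x * cexp (-I * x * ξ)‖ ≤ D * Real.exp (-(ξ ^ 2 / (4 * a)))) :
    ∃ c : ℂ, ∀ ξ : ℝ, ∫ x : ℝ, f x * cexp (-I * x * ξ) = c * cexp (-ξ ^ 2 / (4 * a)) := by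
  set F : ℂ → ℂ := fun z => ∫ x : ℝ, f x * cexp (-I * x * z)
  have hFd : Differentiable ℂ F := differentiable_integral_mul_cexp ha hmeas hf
  set E : ℝ := C * ∫ x : ℝ, Real.exp (-a * x ^ 2)
  have hnorm (z : ℂ) : ‖cexp (z ^ 2 / (4 * a)) * F z‖ =
      Real.exp ((z.re ^ 2 - z.im ^ 2) / (4 * a)) * ‖F z‖ := by
    rw [norm_mul, Complex.norm_exp]
    congr 2
    rw [show (4 * a : ℂ) = ((4 * a : ℝ) : ℂ) by push_cast; rfl, Complex.div_ofReal_re]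
    simp [pow_two]
  have hexp (z : ℂ) : ‖cexp (z ^ 2 / (4 * a)) * F z‖ ≤
      max E D * Real.exp (1 / (4 * a) * z.re ^ 2) := by
    rw [hnorm]
    calc _ ≤ Real.exp ((z.re ^ 2 - z.im ^ 2) / (4 * a)) *
          (E * Real.exp (z.im ^ 2 / (4 * a))) := by
          gcongr
          exact norm_integral_mul_cexp_le ha hf z
      _ = E * Real.exp (1 / (4 * a) * z.re ^ 2) := by
          rw [mul_left_comm, ← Real.exp_add]
          congr 2
          ring
      _ ≤ _ := by
          gcongr
          exact le_max_left _ _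
  have hreal (x : ℝ) : ‖cexp ((x : ℂ) ^ 2 / (4 * a)) * F x‖ ≤ max E D := by
    rw [hnorm]
    calc _ ≤ Real.exp (x ^ 2 / (4 * a)) * (D * Real.exp (-(x ^ 2 / (4 * a)))) := by
          simp only [ofReal_re, ofReal_im, ne_eq, OfNat.ofNat_ne_zero, not_false_eq_true, zero_pow,
            sub_zero]
          gcongr
          exact hfh x
      _ = D := by rw [mul_left_comm, ← Real.exp_add, add_neg_cancel, Real.exp_zero, mul_one]
      _ ≤ _ := le_max_right _ _
  obtain ⟨c, hc⟩ := exists_const_of_norm_le_exp_re_sq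
    (G := fun z => cexp (z ^ 2 / (4 * a)) * F z) (by fun_prop) (by positivity) hexp hreal
  refine ⟨c, fun ξ => ?_⟩
  change F ξ = _
  rw [← hc ξ, mul_right_comm, ← Complex.exp_add, neg_div, add_neg_cancel, Complex.exp_zero, one_mul]

/-- **Hardy's theorem on ℝ, including the sharp case.** With the unitary Fourier
transform `f̂(ξ) = (2π)^{-1/2} ∫ f(x) e^{-ixξ} dx`, if `|f(x)| ≤ C e^{-ax²}` and
`|f̂(ξ)| ≤ C e^{-bξ²}` with `a, b > 0`, then `f ≡ 0` when `ab > 1/4`, and `f` is a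
constant multiple of `e^{-ax²}` when `ab = 1/4`. -/
theorem stmt_11 (f : ℝ → ℂ) (C a b : ℝ) (hC : 0 < C) (ha : 0 < a) (hb : 0 < b)
    (hmeas : AEStronglyMeasurable f volume)
    (fhat : ℝ → ℂ)
    (hfhat : ∀ ξ : ℝ, fhat ξ = (((2 * π) ^ (-(1 : ℝ) / 2) : ℝ) : ℂ) *
      ∫ x : ℝ, f x * Complex.exp (-Complex.I * x * ξ))
    (hf : ∀ x : ℝ, ‖f x‖ ≤ C * Real.exp (-a * x ^ 2))
    (hfh : ∀ ξ : ℝ, ‖fhat ξ‖ ≤ C * Real.exp (-b * ξ ^ 2)) :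
    (a * b > 1 / 4 → f =ᵐ[volume] 0) ∧
    (a * b = 1 / 4 → ∃ c : ℂ, f =ᵐ[volume] fun x => c * Real.exp (-a * x ^ 2)) := by
  set κ : ℝ := (2 * π) ^ (-(1 : ℝ) / 2)
  have hκ : 0 < κ := Real.rpow_pos_of_pos (by positivity) _
  have hF (ξ : ℝ) : ‖∫ x : ℝ, f x * cexp (-I * x * ξ)‖ ≤ C / κ * Real.exp (-b * ξ ^ 2) := by
    have h := hfh ξ
    rw [hfhat, norm_mul, Complex.norm_real, Real.norm_of_nonneg hκ.le] at h
    rw [div_mul_eq_mul_div, le_div_iff₀' hκ]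
    exact h
  have hint : Integrable f := by simpa using integrable_mul_cexp ha hmeas hf 0
  have hgauss : 1 / 4 ≤ a * b →
      ∃ c : ℂ, ∀ ξ : ℝ, ∫ x : ℝ, f x * cexp (-I * x * ξ) = c * cexp (-ξ ^ 2 / (4 * a)) := by
    intro hab
    refine exists_integral_mul_cexp_eq_gaussian (D := C / κ) ha hmeas hf fun ξ =>
      (hF ξ).trans ?_
    gcongr
    rw [neg_mul, neg_le_neg_iff, div_le_iff₀ (by positivity)]
    nlinarith [sq_nonneg ξ]
  constructor
  · intro hab
    obtain ⟨c, hc⟩ := hgauss hab.le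
    have hδ : 0 < b - 1 / (4 * a) := by
      rw [sub_pos, div_lt_iff₀ (by positivity)]
      linarith
    have hle (ξ : ℝ) : ‖c‖ ≤ C / κ * Real.exp (-(b - 1 / (4 * a)) * ξ ^ 2) := by
      have h := hF ξ
      have hn : ‖cexp (-ξ ^ 2 / (4 * a))‖ = Real.exp (-ξ ^ 2 / (4 * a)) := by
        rw [← Complex.norm_of_nonneg (Real.exp_pos _).le]
        push_cast
        rfl
      rw [hc, norm_mul, hn, ← le_div_iff₀ (Real.exp_pos _), mul_div_assoc, ← Real.exp_sub] at h
      refine h.trans_eq ?_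
      congr 2
      ring
    have hlim : Filter.Tendsto (fun ξ : ℝ => C / κ * Real.exp (-(b - 1 / (4 * a)) * ξ ^ 2))
        Filter.atTop (nhds 0) := by
      rw [← mul_zero (C / κ)]
      refine (Real.tendsto_exp_atBot.comp ?_).const_mul _
      exact (Filter.tendsto_pow_atTop two_ne_zero).const_mul_atTop_of_neg (neg_neg_of_pos hδ)
    have hc0 : c = 0 := norm_le_zero_iff.1 (ge_of_tendsto' hlim hle)
    exact ae_eq_zero_of_integral_mul_cexp_eq_zero hint fun ξ => by rw [hc, hc0, zero_mul]
  · intro hab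
    obtain ⟨c, hc⟩ := hgauss hab.ge
    set s : ℂ := (π / a) ^ (1 / 2 : ℂ)
    have hs : s ≠ 0 := by
      simp [s, Complex.cpow_eq_zero_iff, Real.pi_ne_zero, ha.ne']
    refine ⟨c / s, ?_⟩
    have hg : ∀ x : ℝ, ‖c / s * (Real.exp (-a * x ^ 2) : ℂ)‖ ≤
        ‖c / s‖ * Real.exp (-a * x ^ 2) := fun x => by
      rw [norm_mul, Complex.norm_real, Real.norm_of_nonneg (Real.exp_pos _).le]
    have hgmeas : AEStronglyMeasurable
        (fun x : ℝ => c / s * (Real.exp (-a * x ^ 2) : ℂ)) volume := by fun_prop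
    have hgint : Integrable fun x : ℝ => c / s * (Real.exp (-a * x ^ 2) : ℂ) := by
      simpa using integrable_mul_cexp ha hgmeas hg 0
    refine (sub_ae_eq_zero _ _).1 (ae_eq_zero_of_integral_mul_cexp_eq_zero (hint.sub hgint) fun ξ => ?_)
    simp only [Pi.sub_apply, sub_mul]
    rw [integral_sub (integrable_mul_cexp ha hmeas hf ξ) (integrable_mul_cexp ha hgmeas hg ξ), hc,
      sub_eq_zero]
    have h := fourierIntegral_gaussian (b := a) (by simpa using ha) (-ξ)
    calc _ = c / s * (s * cexp (-(-ξ : ℂ) ^ 2 / (4 * a))) := by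
          rw [neg_sq, ← mul_assoc, div_mul_cancel₀ _ hs]
      _ = _ := by
          rw [← h, ← integral_const_mul]
          congr 1 with x
          push_cast
          ring_nf
end

section
/- Let G = SL₂(ℂ), with elementary spherical function φ_λ(a_t) = sin(2λt)/(λ sinh 2t) and Plancherel density |c(λ)|^{-2} = |λ|² (λ ∈ ℝ). Define g on A = {a_t} by g(a_t) = C/sinh(2t) · ∫_ℝ ψ̃(λ) e^{-λ²/16} λP(λ) sin(λt) dλ, where ψ ∈ C_c^∞(ℝ) is even with support in [−ζ,ζ], P is an even polynomial, ψ̃ is its Euclidean Fourier transform, and ψ₁ is the odd Schwartz function with ψ̃₁(λ) = λP(λ)ψ̃(λ). Then for ζ < 1/4 there exist constants C, M > 0 such that |g(a_t)| ≤ C e^{-4t²} e^{-(1−4ζ)2|t|} (1+|t|)^M for all t ∈ ℝ. -/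
open Complex Real MeasureTheory

/-- The Fourier integral of the polynomial `p` times the Gaussian `exp (-b x ^ 2)`. -/
noncomputable def gaussianFourier (b : ℝ) (p : Polynomial ℝ) (s : ℝ) : ℂ :=
  ∫ x : ℝ, ((p.eval x : ℝ) : ℂ) * (cexp (I * s * x) * cexp (-b * x ^ 2))

theorem integrable_eval_mul_exp_neg_mul_sq {b : ℝ} (hb : 0 < b) (p : Polynomial ℝ) :
    Integrable fun x : ℝ => p.eval x * Real.exp (-b * x ^ 2) := by
  induction p using Polynomial.induction_on' with
  | add p q hp hq => simpa only [Polynomial.eval_add, add_mul] using! hp.add hq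
  | monomial n a =>
    have h := (integrable_rpow_mul_exp_neg_mul_sq hb (s := n)
      (by linarith [n.cast_nonneg (α := ℝ)])).const_mul a
    simpa [mul_assoc] using h

theorem norm_cexp_I_mul_mul_cexp_neg_mul_sq (b s x : ℝ) :
    ‖cexp (I * s * x) * cexp (-b * x ^ 2)‖ = Real.exp (-b * x ^ 2) := by
  rw [norm_mul, norm_cexp_neg_mul_sq,
    show I * (s : ℂ) * x = ((s * x : ℝ) : ℂ) * I by push_cast; ring,
    Complex.norm_exp_ofReal_mul_I, one_mul, ofReal_re]

theorem integrable_eval_mul_cexp_gaussian {b : ℝ} (hb : 0 < b) (p : Polynomial ℝ) (s : ℝ) :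
    Integrable fun x : ℝ => ((p.eval x : ℝ) : ℂ) * (cexp (I * s * x) * cexp (-b * x ^ 2)) := by
  refine (integrable_eval_mul_exp_neg_mul_sq hb p).mono ?_ (.of_forall fun x => ?_)
  · have := p.continuous
    exact Continuous.aestronglyMeasurable (by fun_prop)
  · rw [norm_mul, norm_cexp_I_mul_mul_cexp_neg_mul_sq, norm_real, norm_mul,
      Real.norm_of_nonneg (Real.exp_pos _).le]

/-- Integration by parts for the moments of the Fourier-twisted Gaussian. -/
theorem gaussianFourier_X_mul {b : ℝ} (hb : 0 < b) (p : Polynomial ℝ) (s : ℝ) :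
    2 * b * gaussianFourier b (Polynomial.X * p) s =
      gaussianFourier b p.derivative s + I * s * gaussianFourier b p s := by
  have hX := (integrable_eval_mul_cexp_gaussian hb (Polynomial.X * p) s).const_mul (2 * b : ℂ)
  have hD := integrable_eval_mul_cexp_gaussian hb p.derivative s
  have hp := integrable_eval_mul_cexp_gaussian hb p s
  have hI := hp.const_mul (I * s)
  have key := integral_eq_zero_of_hasDerivAt_of_integrable
    (f := fun x : ℝ => ((p.eval x : ℝ) : ℂ) * (cexp (I * s * x) * cexp (-b * x ^ 2)))
    (fun x => ?_) ((hD.add hI).sub hX) hp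
  · rw [integral_sub' (hD.add hI) hX, integral_add' hD hI, integral_const_mul,
      integral_const_mul, sub_eq_zero] at key
    exact key.symm
  · have h1 : HasDerivAt (fun x : ℝ => ((p.eval x : ℝ) : ℂ)) (p.derivative.eval x : ℝ) x :=
      (p.hasDerivAt x).ofReal_comp
    have hx : HasDerivAt (fun x : ℝ => (x : ℂ)) 1 x := by simpa using (hasDerivAt_id x).ofReal_comp
    have h2 := (hx.const_mul (I * (s : ℂ))).cexp
    have h3 := ((hx.pow 2).const_mul (-(b : ℂ))).cexp
    refine (h1.mul (h2.mul h3)).congr_deriv ?_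
    simp
    ring

theorem norm_gaussianFourier_X_pow_le {b : ℝ} (hb : 0 < b) (n : ℕ) :
    ∃ K : ℝ, 0 ≤ K ∧ ∀ s : ℝ,
      ‖gaussianFourier b (Polynomial.X ^ n) s‖ ≤
      K * (1 + |s|) ^ n * Real.exp (-(s ^ 2 / (4 * b))) := by
  induction n using Nat.strong_induction_on with
  | _ n ih =>
  rcases n with _ | n
  · refine ⟨‖((π : ℂ) / b) ^ (1 / 2 : ℂ)‖, norm_nonneg _, fun s => ?_⟩
    have h := fourierIntegral_gaussian (b := (b : ℂ)) (by simpa using hb) s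
    simp only [gaussianFourier, pow_zero, Polynomial.eval_one, ofReal_one, one_mul, mul_one]
    rw [h, norm_mul, Complex.norm_exp]
    apply le_of_eq
    congr 3
    rw [show -(s : ℂ) ^ 2 / (4 * b) = ((-(s ^ 2 / (4 * b)) : ℝ) : ℂ) by push_cast; ring, ofReal_re]
  · obtain ⟨K, hK, h⟩ := ih n n.lt_succ_self
    obtain ⟨L, hL, hD⟩ : ∃ L : ℝ, 0 ≤ L ∧ ∀ s : ℝ,
        ‖gaussianFourier b (Polynomial.X ^ n).derivative s‖ ≤
        L * (1 + |s|) ^ (n + 1) * Real.exp (-(s ^ 2 / (4 * b))) := by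
      rcases n with _ | m
      · exact ⟨0, le_rfl, fun s => by simp [gaussianFourier]⟩
      · obtain ⟨L, hL, h'⟩ := ih m (by omega)
        refine ⟨(m + 1) * L, by positivity, fun s => ?_⟩
        have e : gaussianFourier b (Polynomial.X ^ (m + 1)).derivative s =
            (m + 1) * gaussianFourier b (Polynomial.X ^ m) s := by
          simp only [gaussianFourier]
          rw [← integral_const_mul]
          congr 1 with x
          simp
          ring
        rw [e, norm_mul, show ‖(m + 1 : ℂ)‖ = m + 1 by exact_mod_cast Complex.norm_natCast (m + 1)]
        have hp : (1 + |s|) ^ m ≤ (1 + |s|) ^ (m + 1 + 1) :=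
          pow_le_pow_right₀ (by linarith [abs_nonneg s]) (by omega)
        calc _ ≤ (m + 1) * (L * (1 + |s|) ^ m * Real.exp (-(s ^ 2 / (4 * b)))) := by
              gcongr; exact h' s
          _ ≤ (m + 1) * (L * (1 + |s|) ^ (m + 1 + 1) * Real.exp (-(s ^ 2 / (4 * b)))) := by gcongr
          _ = _ := by ring
    refine ⟨(L + K) / (2 * b), by positivity, fun s => ?_⟩
    have hrec := congrArg norm (gaussianFourier_X_mul hb (Polynomial.X ^ n) s)
    rw [norm_mul, ← pow_succ', show ‖(2 * b : ℂ)‖ = 2 * b by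
      rw [norm_mul, norm_real, Real.norm_of_nonneg hb.le]; simp] at hrec
    have h2b : (0 : ℝ) < 2 * b := by positivity
    rw [← mul_le_mul_iff_right₀ h2b, hrec]
    refine (norm_add_le _ _).trans ?_
    rw [norm_mul, norm_mul, norm_I, one_mul, norm_real, Real.norm_eq_abs]
    calc _ ≤ L * (1 + |s|) ^ (n + 1) * Real.exp (-(s ^ 2 / (4 * b))) +
          (1 + |s|) * (K * (1 + |s|) ^ n * Real.exp (-(s ^ 2 / (4 * b)))) := by
          gcongr
          · exact hD s
          · linarith
          · exact h s
      _ = _ := by field_simp; ring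

/-- The Fourier transform of a polynomial times a Gaussian is bounded by a power times the
dual Gaussian. -/
theorem norm_gaussianFourier_le {b : ℝ} (hb : 0 < b) (p : Polynomial ℝ) :
    ∃ (n : ℕ) (K : ℝ), 0 ≤ K ∧ ∀ s : ℝ,
      ‖gaussianFourier b p s‖ ≤
      K * (1 + |s|) ^ n * Real.exp (-(s ^ 2 / (4 * b))) := by
  induction p using Polynomial.induction_on' with
  | add p q hp hq =>
    obtain ⟨m, K, hK, hp⟩ := hp
    obtain ⟨n, L, hL, hq⟩ := hq
    refine ⟨m + n, K + L, by positivity, fun s => ?_⟩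
    have h1 : 1 ≤ 1 + |s| := by linarith [abs_nonneg s]
    have e : gaussianFourier b (p + q) s = gaussianFourier b p s + gaussianFourier b q s := by
      simp only [gaussianFourier]
      rw [← integral_add (integrable_eval_mul_cexp_gaussian hb p s)
        (integrable_eval_mul_cexp_gaussian hb q s)]
      simp only [Polynomial.eval_add, ofReal_add, add_mul]
    rw [e]
    calc _ ≤ K * (1 + |s|) ^ m * Real.exp (-(s ^ 2 / (4 * b))) +
          L * (1 + |s|) ^ n * Real.exp (-(s ^ 2 / (4 * b))) :=
          (norm_add_le _ _).trans (add_le_add (hp s) (hq s))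
      _ ≤ K * (1 + |s|) ^ (m + n) * Real.exp (-(s ^ 2 / (4 * b))) +
          L * (1 + |s|) ^ (m + n) * Real.exp (-(s ^ 2 / (4 * b))) := by
          gcongr <;> first | exact h1 | omega
      _ = _ := by ring
  | monomial n a =>
    obtain ⟨K, hK, h⟩ := norm_gaussianFourier_X_pow_le hb n
    refine ⟨n, |a| * K, by positivity, fun s => ?_⟩
    have e : gaussianFourier b (Polynomial.monomial n a) s =
        a * gaussianFourier b (Polynomial.X ^ n) s := by
      simp only [gaussianFourier]
      rw [← integral_const_mul]
      congr 1 with x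
      simp [mul_assoc]
    rw [e, norm_mul, norm_real, Real.norm_eq_abs, mul_assoc, mul_assoc |a|, ← mul_assoc K]
    gcongr
    exact h s

/-- The integral of a polynomial times a Gaussian against a complex exponential and a sine. -/
theorem integral_cexp_mul_gaussian_mul_sin {b : ℝ} (hb : 0 < b) (p : Polynomial ℝ) (t x : ℝ) :
    ∫ lam : ℝ, cexp (-I * lam * x) *
        ((p.eval lam * Real.exp (-b * lam ^ 2) * Real.sin (lam * t) : ℝ) : ℂ) =
      I / 2 * (gaussianFourier b p (-t - x) - gaussianFourier b p (t - x)) := by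
  rw [gaussianFourier, gaussianFourier, ← integral_sub (integrable_eval_mul_cexp_gaussian hb p _)
    (integrable_eval_mul_cexp_gaussian hb p _), ← integral_const_mul]
  congr 1 with lam
  have h1 : cexp (I * ((-t - x : ℝ) : ℂ) * lam) = cexp (-I * lam * x) * cexp (-(lam * t) * I) := by
    rw [← Complex.exp_add]; push_cast; ring_nf
  have h2 : cexp (I * ((t - x : ℝ) : ℂ) * lam) = cexp (-I * lam * x) * cexp (lam * t * I) := by
    rw [← Complex.exp_add]; push_cast; ring_nf
  rw [h1, h2]
  push_cast
  rw [Complex.sin]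
  ring

theorem norm_cexp_neg_I_mul_mul (lam x : ℝ) : ‖cexp (-I * lam * x)‖ = 1 := by
  rw [show -I * (lam : ℂ) * x = ((-(lam * x) : ℝ) : ℂ) * I by push_cast; ring,
    Complex.norm_exp_ofReal_mul_I]

theorem integrable_eval_mul_exp_neg_mul_sq_mul_sin {b : ℝ} (hb : 0 < b) (p : Polynomial ℝ)
    (t : ℝ) :
    Integrable fun lam : ℝ => p.eval lam * Real.exp (-b * lam ^ 2) * Real.sin (lam * t) := by
  refine (integrable_eval_mul_exp_neg_mul_sq hb p).mono ?_ (.of_forall fun x => ?_)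
  · have := p.continuous
    exact Continuous.aestronglyMeasurable (by fun_prop)
  · rw [norm_mul]
    exact mul_le_of_le_one_right (norm_nonneg _) (Real.abs_sin_le_one _)

theorem integral_fourier_mul_gaussian_mul_sin {b : ℝ} (hb : 0 < b) (p : Polynomial ℝ)
    {ψ : ℝ → ℝ} (hc : Continuous ψ) (hψ : Integrable ψ) (t : ℝ) :
    ∫ lam : ℝ, (∫ x : ℝ, (ψ x : ℂ) * cexp (-I * lam * x)) *
        ((p.eval lam * Real.exp (-b * lam ^ 2) * Real.sin (lam * t) : ℝ) : ℂ) =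
      ∫ x : ℝ, (ψ x : ℂ) *
        (I / 2 * (gaussianFourier b p (-t - x) - gaussianFourier b p (t - x))) := by
  simp_rw [← integral_cexp_mul_gaussian_mul_sin hb p t, ← integral_const_mul,
    ← integral_mul_const, ← mul_assoc]
  apply integral_integral_swap
  have hprod := (integrable_eval_mul_exp_neg_mul_sq_mul_sin hb p t).mul_prod hψ
  refine hprod.mono ?_ (.of_forall fun z => ?_)
  · have := p.continuous
    exact Continuous.aestronglyMeasurable (by unfold Function.uncurry; fun_prop)
  · rw [Function.uncurry, norm_mul, norm_mul, norm_cexp_neg_I_mul_mul, norm_real, norm_real,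
      mul_one, mul_comm, ← norm_mul]

/-- A function supported in `[-ζ, ζ]` is smeared by the Gaussian with a loss of at most
`exp (ζ |t| / (2 b))`. -/
theorem norm_integral_fourier_mul_gaussian_mul_sin_le {b ζ : ℝ} (hb : 0 < b) (p : Polynomial ℝ)
    {ψ : ℝ → ℝ} (hc : Continuous ψ) (hψ : Integrable ψ)
    (hsupp : Function.support ψ ⊆ Set.Icc (-ζ) ζ) :
    ∃ (n : ℕ) (K : ℝ), 0 ≤ K ∧ ∀ t : ℝ,
      ‖∫ lam : ℝ, (∫ x : ℝ, (ψ x : ℂ) * cexp (-I * lam * x)) *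
        ((p.eval lam * Real.exp (-b * lam ^ 2) * Real.sin (lam * t) : ℝ) : ℂ)‖ ≤
      K * (1 + |t|) ^ n * Real.exp ((-t ^ 2 + 2 * ζ * |t|) / (4 * b)) := by
  obtain ⟨n, K, hK, h⟩ := norm_gaussianFourier_le hb p
  refine ⟨n, (∫ x, |ψ x|) * (K * (1 + |ζ|) ^ n), by positivity, fun t => ?_⟩
  rw [integral_fourier_mul_gaussian_mul_sin hb p hc hψ]
  have bound : ∀ u x : ℝ, |u| = |t| → |x| ≤ ζ → ‖gaussianFourier b p (u - x)‖ ≤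
      K * ((1 + |ζ|) * (1 + |t|)) ^ n * Real.exp ((-t ^ 2 + 2 * ζ * |t|) / (4 * b)) := by
    intro u x hu hx
    refine (h _).trans ?_
    have hxζ : |x| ≤ |ζ| := hx.trans (le_abs_self ζ)
    have h1 : 1 + |u - x| ≤ (1 + |ζ|) * (1 + |t|) := by
      have := abs_sub u x
      nlinarith [mul_nonneg (abs_nonneg ζ) (abs_nonneg t)]
    have h2 : -((u - x) ^ 2 / (4 * b)) ≤ (-t ^ 2 + 2 * ζ * |t|) / (4 * b) := by
      rw [← neg_div]
      gcongr
      have hux : u * x ≤ |t| * ζ := by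
        rw [← hu]
        refine (le_abs_self _).trans ?_
        rw [abs_mul]
        gcongr
      have hsq : u ^ 2 = t ^ 2 := sq_eq_sq_iff_abs_eq_abs _ _ |>.mpr hu
      nlinarith [sq_nonneg x]
    gcongr
  have key : ∀ x : ℝ, ‖(ψ x : ℂ) *
      (I / 2 * (gaussianFourier b p (-t - x) - gaussianFourier b p (t - x)))‖ ≤
      |ψ x| * (K * ((1 + |ζ|) * (1 + |t|)) ^ n *
        Real.exp ((-t ^ 2 + 2 * ζ * |t|) / (4 * b))) := by
    intro x
    rw [norm_mul, norm_real, Real.norm_eq_abs]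
    by_cases hx : ψ x = 0
    · simp [hx]
    · have hx' : |x| ≤ ζ := abs_le.mpr (hsupp hx)
      gcongr
      rw [norm_mul, show ‖I / 2‖ = 1 / 2 by simp]
      have := norm_sub_le (gaussianFourier b p (-t - x)) (gaussianFourier b p (t - x))
      linarith [bound (-t) x (abs_neg t) hx', bound t x rfl hx']
  refine (norm_integral_le_of_norm_le (hψ.abs.mul_const _) (.of_forall key)).trans_eq ?_
  rw [integral_mul_const, mul_pow]
  ring

theorem norm_integral_fourier_mul_gaussian_mul_sin_le_mul_abs {b : ℝ} (hb : 0 < b)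
    (p : Polynomial ℝ) {ψ : ℝ → ℝ} :
    ∃ K : ℝ, 0 ≤ K ∧ ∀ t : ℝ,
      ‖∫ lam : ℝ, (∫ x : ℝ, (ψ x : ℂ) * cexp (-I * lam * x)) *
        ((p.eval lam * Real.exp (-b * lam ^ 2) * Real.sin (lam * t) : ℝ) : ℂ)‖ ≤ K * |t| := by
  have hi := (integrable_eval_mul_exp_neg_mul_sq hb (Polynomial.X * p)).abs.const_mul
    (∫ x, |ψ x|)
  refine ⟨∫ lam, (∫ x, |ψ x|) * |(Polynomial.X * p).eval lam * Real.exp (-b * lam ^ 2)|,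
    integral_nonneg fun _ => by positivity, fun t => ?_⟩
  refine (norm_integral_le_of_norm_le (hi.mul_const |t|) (.of_forall fun lam => ?_)).trans_eq
    (integral_mul_const _ _)
  rw [norm_mul, norm_real, mul_assoc (∫ x, |ψ x|)]
  gcongr
  · refine (norm_integral_le_integral_norm _).trans_eq ?_
    simp only [norm_mul, norm_cexp_neg_I_mul_mul, norm_real, Real.norm_eq_abs, mul_one]
  · rw [Real.norm_eq_abs, abs_mul]
    calc _ ≤ |Polynomial.eval lam p * Real.exp (-b * lam ^ 2)| * |lam * t| := by
          gcongr ?_ * ?_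
          exact Real.abs_sin_le_abs
      _ = _ := by
          simp only [Polynomial.eval_mul, Polynomial.eval_X, abs_mul]
          ring

theorem exp_le_four_mul_sinh {u : ℝ} (hu : 1 ≤ u) : Real.exp u ≤ 4 * Real.sinh u := by
  rw [Real.sinh_eq]
  have h1 := Real.add_one_le_exp u
  have h2 : Real.exp (-u) ≤ 1 := Real.exp_le_one_iff.mpr (by linarith)
  linarith

/-- **The `SL₂(ℂ)` sharpness example.** With `ψ ∈ C_c^∞(ℝ)` even, supported in
`[-ζ,ζ]`, `P` an even polynomial, and
`g(a_t) = C/sinh(2t) ∫ ψ̃(λ) e^{-λ²/16} λ P(λ) sin(λt) dλ`,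
if `ζ < 1/4` then `|g(a_t)| ≤ C' e^{-4t²} e^{-(1-4ζ)2|t|} (1+|t|)^M`. -/
theorem stmt_18 (ζ : ℝ) (hζ : 0 < ζ) (hζ' : ζ < 1 / 4)
    (ψ : ℝ → ℝ) (hsmooth : ContDiff ℝ (⊤ : ℕ∞) ψ) (heven : ∀ x, ψ (-x) = ψ x)
    (hsupp : Function.support ψ ⊆ Set.Icc (-ζ) ζ)
    (P : Polynomial ℝ) (hPeven : ∀ x : ℝ, P.eval (-x) = P.eval x)
    (C : ℝ)
    (ψt : ℝ → ℂ)
    (hψt : ∀ lam : ℝ, ψt lam = ∫ x : ℝ, (ψ x : ℂ) * Complex.exp (-Complex.I * lam * x))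
    (g : ℝ → ℂ)
    (hg : ∀ t : ℝ, g t = (C : ℂ) / (Real.sinh (2 * t) : ℝ) *
      ∫ lam : ℝ, ψt lam * (Real.exp (-lam ^ 2 / 16) : ℝ) * (lam : ℂ) *
        (P.eval lam : ℝ) * (Real.sin (lam * t) : ℝ)) :
    ∃ C' M : ℝ, 0 < C' ∧ 0 < M ∧ ∀ t : ℝ,
      ‖g t‖ ≤ C' * Real.exp (-4 * t ^ 2) *
        Real.exp (-(1 - 4 * ζ) * 2 * |t|) * (1 + |t|) ^ M := by
  have hb : (0 : ℝ) < 1 / 16 := by norm_num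
  have hψ : Integrable ψ := hsmooth.continuous.integrable_of_hasCompactSupport
    (HasCompactSupport.of_support_subset_isCompact isCompact_Icc hsupp)
  obtain ⟨n, K, hK, hlarge⟩ := norm_integral_fourier_mul_gaussian_mul_sin_le hb (Polynomial.X * P)
    hsmooth.continuous hψ hsupp
  obtain ⟨L, hL, hsmall⟩ := norm_integral_fourier_mul_gaussian_mul_sin_le_mul_abs hb
    (Polynomial.X * P) (ψ := ψ)
  have hnorm : ∀ t, ‖g t‖ = |C| / Real.sinh (2 * |t|) *
      ‖∫ lam : ℝ, (∫ x : ℝ, (ψ x : ℂ) * cexp (-I * lam * x)) *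
        (((Polynomial.X * P).eval lam * Real.exp (-(1 / 16) * lam ^ 2) *
          Real.sin (lam * t) : ℝ) : ℂ)‖ := by
    intro t
    rw [hg, norm_mul, norm_div, norm_real, norm_real, Real.norm_eq_abs, Real.norm_eq_abs,
      Real.abs_sinh, abs_mul, abs_two]
    congr 3 with lam
    rw [hψt, show -lam ^ 2 / 16 = -(1 / 16) * lam ^ 2 by ring, Polynomial.eval_mul,
      Polynomial.eval_X]
    push_cast
    ring
  refine ⟨4 * |C| * K + |C| * L * Real.exp 6 + 1, n + 1, by positivity, by positivity,
    fun t => ?_⟩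
  have hpow : (1 + |t|) ^ n ≤ (1 + |t|) ^ ((n : ℝ) + 1) := by
    rw [← Real.rpow_natCast]
    exact Real.rpow_le_rpow_of_exponent_le (by linarith [abs_nonneg t]) (by linarith)
  rw [hnorm]
  rcases le_total |t| 1 with ht | ht
  · have hone : (1 : ℝ) ≤ (1 + |t|) ^ ((n : ℝ) + 1) :=
      Real.one_le_rpow (by linarith [abs_nonneg t]) (by positivity)
    have hexp : 1 ≤ Real.exp 6 * Real.exp (-4 * t ^ 2) *
        Real.exp (-(1 - 4 * ζ) * 2 * |t|) := by
      rw [← Real.exp_add, ← Real.exp_add, Real.one_le_exp_iff]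
      have : t ^ 2 ≤ 1 := (sq_le_one_iff_abs_le_one t).mpr ht
      nlinarith [mul_nonneg hζ.le (abs_nonneg t)]
    have hquot : |C| / Real.sinh (2 * |t|) * (L * |t|) ≤ |C| * L := by
      have hs : |t| ≤ Real.sinh (2 * |t|) :=
        (by linarith [abs_nonneg t] : |t| ≤ 2 * |t|).trans
          (Real.self_le_sinh_iff.mpr (by positivity))
      calc _ = |C| * L * (|t| / Real.sinh (2 * |t|)) := by ring
        _ ≤ |C| * L * 1 := by
          gcongr
          exact div_le_one_of_le₀ hs ((abs_nonneg t).trans hs)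
        _ = _ := mul_one _
    have hs0 : 0 ≤ Real.sinh (2 * |t|) := Real.sinh_nonneg_iff.mpr (by positivity)
    calc _ ≤ |C| / Real.sinh (2 * |t|) * (L * |t|) := by gcongr; exact hsmall t
      _ ≤ |C| * L * 1 * 1 := by simpa using hquot
      _ ≤ |C| * L * (Real.exp 6 * Real.exp (-4 * t ^ 2) *
          Real.exp (-(1 - 4 * ζ) * 2 * |t|)) * (1 + |t|) ^ ((n : ℝ) + 1) := by gcongr
      _ = (|C| * L * Real.exp 6) * Real.exp (-4 * t ^ 2) *
          Real.exp (-(1 - 4 * ζ) * 2 * |t|) * (1 + |t|) ^ ((n : ℝ) + 1) := by ring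
      _ ≤ _ := by
        gcongr
        linarith [show 0 ≤ 4 * |C| * K by positivity]
  · have hsinh := exp_le_four_mul_sinh (u := 2 * |t|) (by linarith)
    have hquot : |C| / Real.sinh (2 * |t|) ≤ 4 * |C| * Real.exp (-(2 * |t|)) := by
      rw [Real.exp_neg, ← div_eq_mul_inv, div_le_div_iff₀ (by linarith [Real.exp_pos (2 * |t|)])
        (Real.exp_pos _)]
      nlinarith [mul_le_mul_of_nonneg_left hsinh (abs_nonneg C)]
    calc _ ≤ 4 * |C| * Real.exp (-(2 * |t|)) *
          (K * (1 + |t|) ^ n * Real.exp ((-t ^ 2 + 2 * ζ * |t|) / (4 * (1 / 16)))) := by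
          gcongr; exact hlarge t
      _ = (4 * |C| * K) * (Real.exp (-(2 * |t|)) *
          Real.exp ((-t ^ 2 + 2 * ζ * |t|) / (4 * (1 / 16)))) * (1 + |t|) ^ n := by ring
      _ = (4 * |C| * K) * Real.exp (-4 * t ^ 2) *
          Real.exp (-(1 - 4 * ζ) * 2 * |t|) * (1 + |t|) ^ n := by
          rw [mul_assoc (4 * |C| * K) (Real.exp (-4 * t ^ 2)), ← Real.exp_add, ← Real.exp_add]
          ring_nf
      _ ≤ _ := by
        gcongr
        linarith [show 0 ≤ |C| * L * Real.exp 6 by positivity]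
end
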